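/- Let K be a finitely generated abelian group, S ⊆ K a finitely generated submonoid with saturation S̃, and let C ∈ c(S̃/S) be an element of the conductor ideal. If w ∈ K satisfies w ⊗ 1 ∈ (C ⊗ 1) + cone(S) in K ⊗_ℤ ℚ, then w ∈ S. -/

import Mathlib

open scoped TensorProduct

/-- The saturation of a submonoid `S` of an abelian group `K`:
all `w ∈ K` with `n • w ∈ S` for some integer `n ≥ 1`. -/
def saturation {K : Type} [AddCommGroup K] (S : AddSubmonoid K) : Set K :=
  {w | ∃ n : ℕ, 1 ≤ n ∧ n • w ∈ S}

/-- The conductor ideal `c(S̃/S) = {x ∈ S : x + S̃ ⊆ S}`. -/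
def conductorIdeal {K : Type} [AddCommGroup K] (S : AddSubmonoid K) : Set K :=
  {x | x ∈ S ∧ ∀ s ∈ saturation S, x + s ∈ S}

/-- The cone generated by a submonoid `S ⊆ K` inside `K ⊗_ℤ ℚ`
(realised as `ℚ ⊗[ℤ] K`): all finite nonnegative rational combinations
of the elements `s ⊗ 1`, `s ∈ S`. -/
noncomputable def coneOf {K : Type} [AddCommGroup K] (S : AddSubmonoid K) :
    AddSubmonoid (ℚ ⊗[ℤ] K) :=
  AddSubmonoid.closure {v | ∃ a : ℚ, ∃ s ∈ S, 0 ≤ a ∧ v = a • ((1 : ℚ) ⊗ₜ[ℤ] s)}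

/-- Every element of the cone has a positive integer multiple of the form `1 ⊗ s`, `s ∈ S`. -/
theorem exists_nsmul_eq_tmul_of_mem_coneOf {K : Type} [AddCommGroup K] {S : AddSubmonoid K}
    {v : ℚ ⊗[ℤ] K} (hv : v ∈ coneOf S) :
    ∃ n : ℕ, 1 ≤ n ∧ ∃ s ∈ S, n • v = (1 : ℚ) ⊗ₜ[ℤ] s := by
  induction hv using AddSubmonoid.closure_induction with
  | mem v hv =>
    obtain ⟨a, s, hs, ha, rfl⟩ := hv
    refine ⟨a.den, a.pos, a.num.toNat • s, S.nsmul_mem hs _, ?_⟩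
    have hnum : (a.num.toNat : ℚ) = a.num := by
      exact_mod_cast Int.toNat_of_nonneg (Rat.num_nonneg.mpr ha)
    rw [TensorProduct.tmul_smul, ← Nat.cast_smul_eq_nsmul ℚ, ← Nat.cast_smul_eq_nsmul ℚ, smul_smul,
      mul_comm, Rat.mul_den_eq_num, hnum]
  | zero => exact ⟨1, le_rfl, 0, S.zero_mem, by simp⟩
  | add x y _ _ hx hy =>
    obtain ⟨m, hm, s, hs, hms⟩ := hx
    obtain ⟨n, hn, t, ht, hnt⟩ := hy
    refine ⟨m * n, Nat.mul_pos hm hn, n • s + m • t,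
      S.add_mem (S.nsmul_mem hs _) (S.nsmul_mem ht _), ?_⟩
    rw [TensorProduct.tmul_add, TensorProduct.tmul_smul, TensorProduct.tmul_smul, ← hms, ← hnt,
      smul_add, mul_smul, mul_smul, smul_comm m n x]

/-- The kernel of `K → ℚ ⊗[ℤ] K` consists of torsion elements. -/
theorem exists_nsmul_eq_zero_of_one_tmul_eq_zero {K : Type} [AddCommGroup K] {x : K}
    (hx : (1 : ℚ) ⊗ₜ[ℤ] x = 0) : ∃ n : ℕ, 1 ≤ n ∧ n • x = 0 := by
  have : IsLocalizedModule (nonZeroDivisors ℤ) (TensorProduct.mk ℤ ℚ K 1) :=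
    (isLocalizedModule_iff_isBaseChange (nonZeroDivisors ℤ) ℚ _).mpr
      (TensorProduct.isBaseChange ℤ K ℚ)
  obtain ⟨c, hc⟩ := (IsLocalizedModule.eq_zero_iff (nonZeroDivisors ℤ)
    (TensorProduct.mk ℤ ℚ K 1)).mp hx
  refine ⟨(c : ℤ).natAbs, Int.natAbs_pos.mpr (nonZeroDivisors.coe_ne_zero c), ?_⟩
  exact natAbs_nsmul_eq_zero.mpr hc

/-- If `C` is an element of the conductor ideal of `S` and
`w ⊗ 1 ∈ (C ⊗ 1) + cone(S)`, then `w ∈ S`. -/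
theorem mem_of_mem_translated_cone {K : Type} [AddCommGroup K]
    (hK : AddGroup.FG K) (S : AddSubmonoid K) (hS : S.FG)
    (C : K) (hC : C ∈ conductorIdeal S) (w : K)
    (hw : ∃ v ∈ coneOf S, (1 : ℚ) ⊗ₜ[ℤ] w = (1 : ℚ) ⊗ₜ[ℤ] C + v) :
    w ∈ S := by
  obtain ⟨v, hv, hwv⟩ := hw
  obtain ⟨n, hn, s, hs, hns⟩ := exists_nsmul_eq_tmul_of_mem_coneOf hv
  have hker : (1 : ℚ) ⊗ₜ[ℤ] (n • (w - C) - s) = 0 := by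
    rw [TensorProduct.tmul_sub, TensorProduct.tmul_smul, TensorProduct.tmul_sub, hwv,
      add_sub_cancel_left, hns, sub_self]
  obtain ⟨m, hm, hms⟩ := exists_nsmul_eq_zero_of_one_tmul_eq_zero hker
  rw [smul_sub, sub_eq_zero, ← mul_smul] at hms
  have hsat : w - C ∈ saturation S :=
    ⟨m * n, Nat.mul_pos hm hn, hms ▸ S.nsmul_mem hs m⟩
  simpa using hC.2 _ hsat
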